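/- arXiv:1509.05480 — 10 statements merged into one kernel-verified Lean document; each statement's English description precedes it below -/
import Mathlib

section
/- Let (x, y) be a Nash equilibrium of the two-player unit-sphere game with payoff matrices A and B, and set λ = ‖Ay‖₂ and μ = ‖Bx‖₂. Then (AB)x = λμ·x and (BA)y = λμ·y; in particular, λμ ≥ 0 is a common eigenvalue of AB and BA, with eigenvectors x and y respectively. -/
open Matrix Finset

/-- A unit vector maximizing the pairing with `v` over the unit sphere satisfies `v = ‖v‖₂ • x`. -/
theorem eq_sqrt_smul_of_forall_dotProduct_le {ι : Type*} [Fintype ι] {x v : ι → ℝ}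
    (hx : ∑ i, x i ^ 2 = 1)
    (hmax : ∀ x' : ι → ℝ, ∑ i, x' i ^ 2 = 1 → x' ⬝ᵥ v ≤ x ⬝ᵥ v) :
    v = Real.sqrt (∑ i, v i ^ 2) • x := by
  have hv : 0 ≤ ∑ i, v i ^ 2 := sum_nonneg fun i _ => sq_nonneg _
  have hsq := Real.sq_sqrt hv
  have hs := Real.sqrt_nonneg (∑ i, v i ^ 2)
  generalize Real.sqrt (∑ i, v i ^ 2) = s at hsq hs ⊢
  have hle : s * s ≤ s * (x ⬝ᵥ v) := by
    rcases hs.eq_or_lt with rfl | hpos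
    · simp
    · have h := hmax (s⁻¹ • v) (by
        simp only [Pi.smul_apply, smul_eq_mul, mul_pow, ← mul_sum, ← hsq]
        field_simp)
      have hvv : v ⬝ᵥ v = s ^ 2 := by simp only [dotProduct, hsq, sq]
      rw [smul_dotProduct, hvv, smul_eq_mul, sq, inv_mul_cancel_left₀ hpos.ne'] at h
      gcongr
  have hexp : ∑ i, (v i - s * x i) ^ 2 = s ^ 2 - 2 * (s * (x ⬝ᵥ v)) + s ^ 2 := by
    calc ∑ i, (v i - s * x i) ^ 2
        = ∑ i, v i ^ 2 - 2 * (s * (x ⬝ᵥ v)) + s ^ 2 * ∑ i, x i ^ 2 := by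
          simp only [dotProduct, mul_sum, ← sum_sub_distrib, ← sum_add_distrib]
          exact sum_congr rfl fun i _ => by ring
      _ = _ := by rw [hx, hsq, mul_one]
  have hzero : ∑ i, (v i - s * x i) ^ 2 = 0 :=
    le_antisymm (by linarith) (sum_nonneg fun i _ => sq_nonneg _)
  ext i
  have hi := (sum_eq_zero_iff_of_nonneg fun i _ => sq_nonneg _).mp hzero i (mem_univ i)
  exact sub_eq_zero.mp (pow_eq_zero_iff two_ne_zero |>.mp hi)

/-- at a Nash equilibrium `(x, y)` of the two-player unit-sphere game
with payoff matrices `A` and `B`, setting `λ = ‖Ay‖₂` and `μ = ‖Bx‖₂`, we have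
`(AB)x = λμ • x`, `(BA)y = λμ • y`, and `λμ ≥ 0`; in particular `λμ` is a common
eigenvalue of `AB` and `BA` with (unit, hence nonzero) eigenvectors `x` and `y`. -/
theorem unit_sphere_game_ne_eigen {m n : ℕ}
    (A : Matrix (Fin m) (Fin n) ℝ) (B : Matrix (Fin n) (Fin m) ℝ)
    (x : Fin m → ℝ) (y : Fin n → ℝ)
    (hx : ∑ i, x i ^ 2 = 1) (hy : ∑ j, y j ^ 2 = 1)
    (hNE1 : ∀ x' : Fin m → ℝ, ∑ i, x' i ^ 2 = 1 →
      x' ⬝ᵥ A.mulVec y ≤ x ⬝ᵥ A.mulVec y)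
    (hNE2 : ∀ y' : Fin n → ℝ, ∑ j, y' j ^ 2 = 1 →
      y' ⬝ᵥ B.mulVec x ≤ y ⬝ᵥ B.mulVec x)
    (lam mu : ℝ)
    (hlam : lam = Real.sqrt (∑ i, A.mulVec y i ^ 2))
    (hmu : mu = Real.sqrt (∑ j, B.mulVec x j ^ 2)) :
    0 ≤ lam * mu ∧
    (A * B).mulVec x = (lam * mu) • x ∧
    (B * A).mulVec y = (lam * mu) • y ∧
    x ≠ 0 ∧ y ≠ 0 := by
  have hAy : A.mulVec y = lam • x := hlam ▸ eq_sqrt_smul_of_forall_dotProduct_le hx hNE1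
  have hBx : B.mulVec x = mu • y := hmu ▸ eq_sqrt_smul_of_forall_dotProduct_le hy hNE2
  refine ⟨?_, ?_, ?_, ?_, ?_⟩
  · rw [hlam, hmu]
    positivity
  · rw [← mulVec_mulVec, hBx, mulVec_smul, hAy, smul_smul, mul_comm]
  · rw [← mulVec_mulVec, hAy, mulVec_smul, hBx, smul_smul]
  · rintro rfl
    simp at hx
  · rintro rfl
    simp at hy
end

section
/- Let A (m×n) and B (n×m) be real matrices. If the matrices AB and BA do not share a nonnegative real eigenvalue, then the two-player unit-sphere game with payoff matrices A and B has no Nash equilibrium. -/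
open Matrix Finset

/-- A unit vector maximizing the linear form `u ↦ u ⬝ᵥ v` over the unit sphere is a
nonnegative rescaling of `v`. -/
theorem exists_nonneg_smul_eq_of_forall_dotProduct_le {ι : Type*} [Fintype ι] (x v : ι → ℝ)
    (hx : ∑ i, x i ^ 2 = 1)
    (hmax : ∀ u : ι → ℝ, ∑ i, u i ^ 2 = 1 → u ⬝ᵥ v ≤ x ⬝ᵥ v) :
    ∃ c : ℝ, 0 ≤ c ∧ v = c • x := by
  by_cases hv : v = 0
  · exact ⟨0, le_rfl, by simp [hv]⟩
  have hself (u : ι → ℝ) : u ⬝ᵥ u = ∑ i, u i ^ 2 := by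
    simp [dotProduct, sq]
  have hpos : 0 < v ⬝ᵥ v :=
    lt_of_le_of_ne (by rw [hself]; positivity) (fun h0 => hv (dotProduct_self_eq_zero.1 h0.symm))
  obtain ⟨c, hc, hcv⟩ : ∃ c : ℝ, 0 < c ∧ v ⬝ᵥ v = c * c :=
    ⟨√(v ⬝ᵥ v), Real.sqrt_pos.2 hpos, (Real.mul_self_sqrt hpos.le).symm⟩
  have hle : c ≤ x ⬝ᵥ v := by
    have hu := hmax (c⁻¹ • v) (by
      rw [← hself, smul_dotProduct, dotProduct_smul, hcv, smul_eq_mul, smul_eq_mul]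
      field_simp)
    rw [smul_dotProduct, hcv, smul_eq_mul, inv_mul_cancel_left₀ hc.ne'] at hu
    exact hu
  refine ⟨c, hc.le, sub_eq_zero.1 (dotProduct_self_eq_zero.1 (le_antisymm ?_ ?_))⟩
  · have hexp : (v - c • x) ⬝ᵥ (v - c • x) = c * c - 2 * c * (x ⬝ᵥ v) + c * c := by
      simp only [sub_dotProduct, dotProduct_sub, smul_dotProduct, dotProduct_smul, smul_eq_mul,
        hcv, dotProduct_comm v x, hself x, hx]
      ring
    rw [hexp]
    nlinarith
  · rw [hself]
    positivity

/-- if `AB` and `BA` do not share a nonnegative real eigenvalue, then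
the two-player unit-sphere game with payoff matrices `A` and `B` has no Nash
equilibrium. -/
theorem unit_sphere_game_no_ne_of_no_shared_nonneg_eigenvalue {m n : ℕ}
    (A : Matrix (Fin m) (Fin n) ℝ) (B : Matrix (Fin n) (Fin m) ℝ)
    (h : ¬ ∃ lam : ℝ, 0 ≤ lam ∧
      (∃ x : Fin m → ℝ, x ≠ 0 ∧ (A * B).mulVec x = lam • x) ∧
      (∃ y : Fin n → ℝ, y ≠ 0 ∧ (B * A).mulVec y = lam • y)) :
    ¬ ∃ (x : Fin m → ℝ) (y : Fin n → ℝ),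
      (∑ i, x i ^ 2 = 1) ∧ (∑ j, y j ^ 2 = 1) ∧
      (∀ x' : Fin m → ℝ, ∑ i, x' i ^ 2 = 1 →
        x' ⬝ᵥ A.mulVec y ≤ x ⬝ᵥ A.mulVec y) ∧
      (∀ y' : Fin n → ℝ, ∑ j, y' j ^ 2 = 1 →
        y' ⬝ᵥ B.mulVec x ≤ y ⬝ᵥ B.mulVec x) := by
  rintro ⟨x, y, hx, hy, hA, hB⟩
  obtain ⟨a, ha, hAy⟩ := exists_nonneg_smul_eq_of_forall_dotProduct_le x _ hx hA
  obtain ⟨b, hb, hBx⟩ := exists_nonneg_smul_eq_of_forall_dotProduct_le y _ hy hB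
  refine h ⟨a * b, mul_nonneg ha hb, ⟨x, ?_, ?_⟩, ⟨y, ?_, ?_⟩⟩
  · rintro rfl
    simp at hx
  · rw [← mulVec_mulVec, hBx, mulVec_smul, hAy, smul_smul, mul_comm]
  · rintro rfl
    simp at hy
  · rw [← mulVec_mulVec, hAy, mulVec_smul, hBx, smul_smul]
end

section
/- Let A (m×n) and B (n×m) be entrywise positive real matrices. Suppose x₁ ∈ ℝ^m is entrywise positive with ‖x₁‖₂ = 1 and (AB)x₁ = λ·x₁ for some λ > 0, and set y₁ = Bx₁/‖Bx₁‖₂. Then (x₁, y₁) is a Nash equilibrium of the positive unit-sphere game with payoff matrices A and B, and the equilibrium payoffs are λ/‖Bx₁‖₂ for player 1 and ‖Bx₁‖₂ for player 2. -/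
open Matrix Finset

/-- Two vectors of unit `ℓ²`-norm have dot product at most one. -/
theorem dotProduct_le_one_of_sum_sq_eq_one {ι : Type*} [Fintype ι] {u v : ι → ℝ}
    (hu : ∑ i, u i ^ 2 = 1) (hv : ∑ i, v i ^ 2 = 1) : u ⬝ᵥ v ≤ 1 := by
  have h := sum_mul_sq_le_sq_mul_sq univ u v
  rw [hu, hv] at h
  exact (abs_le_of_sq_le_sq' (by simpa [dotProduct] using h) zero_le_one).2

/-- in a positive unit-sphere game with payoff matrices `A`, `B`, if
`x₁ > 0` is a unit eigenvector of `AB` with eigenvalue `λ > 0` and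
`y₁ = Bx₁ / ‖Bx₁‖₂`, then `(x₁, y₁)` is a Nash equilibrium of the PUSG with
payoffs `λ/‖Bx₁‖₂` for player 1 and `‖Bx₁‖₂` for player 2. -/
theorem pusg_ne_from_perron_eigenvector {m n : ℕ}
    (A : Matrix (Fin m) (Fin n) ℝ) (B : Matrix (Fin n) (Fin m) ℝ)
    (hA : ∀ i j, 0 < A i j) (hB : ∀ j i, 0 < B j i)
    (x1 : Fin m → ℝ) (hx1pos : ∀ i, 0 < x1 i) (hx1unit : ∑ i, x1 i ^ 2 = 1)
    (lam : ℝ) (hlam : 0 < lam) (heig : (A * B).mulVec x1 = lam • x1)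
    (mu : ℝ) (hmu : mu = Real.sqrt (∑ j, B.mulVec x1 j ^ 2))
    (y1 : Fin n → ℝ) (hy1 : y1 = mu⁻¹ • B.mulVec x1) :
    (∀ j, 0 ≤ y1 j) ∧ (∑ j, y1 j ^ 2 = 1) ∧
    (∀ x' : Fin m → ℝ, (∀ i, 0 ≤ x' i) → ∑ i, x' i ^ 2 = 1 →
      x' ⬝ᵥ A.mulVec y1 ≤ x1 ⬝ᵥ A.mulVec y1) ∧
    (∀ y' : Fin n → ℝ, (∀ j, 0 ≤ y' j) → ∑ j, y' j ^ 2 = 1 →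
      y' ⬝ᵥ B.mulVec x1 ≤ y1 ⬝ᵥ B.mulVec x1) ∧
    x1 ⬝ᵥ A.mulVec y1 = lam / mu ∧
    y1 ⬝ᵥ B.mulVec x1 = mu := by
  have hself {k : ℕ} (v : Fin k → ℝ) : v ⬝ᵥ v = ∑ i, v i ^ 2 := by
    simp [dotProduct, sq]
  have hBx : ∀ j, 0 ≤ (B *ᵥ x1) j := fun j => by
    simp only [mulVec, dotProduct]
    exact sum_nonneg fun i _ => (mul_pos (hB j i) (hx1pos i)).le
  have hmu_sq : mu ^ 2 = ∑ j, (B *ᵥ x1) j ^ 2 := by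
    rw [hmu, Real.sq_sqrt (sum_nonneg fun j _ => sq_nonneg _)]
  have hmu_ne : mu ≠ 0 := by
    rintro rfl
    have hzero : B *ᵥ x1 = 0 := by
      rw [← dotProduct_self_eq_zero, hself, ← hmu_sq]
      norm_num
    rw [← mulVec_mulVec, hzero, mulVec_zero] at heig
    have h := congrArg (x1 ⬝ᵥ ·) heig
    simp only [dotProduct_zero, dotProduct_smul, hself, hx1unit, smul_eq_mul, mul_one] at h
    exact hlam.ne h
  have hmu_nonneg : 0 ≤ mu := hmu ▸ Real.sqrt_nonneg _
  have hBx_eq : B *ᵥ x1 = mu • y1 := by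
    rw [hy1, smul_inv_smul₀ hmu_ne]
  have hAy_eq : A *ᵥ y1 = (lam / mu) • x1 := by
    rw [hy1, mulVec_smul, mulVec_mulVec, heig, smul_smul, div_eq_inv_mul]
  have hy1unit : ∑ j, y1 j ^ 2 = 1 := by
    simp only [hy1, Pi.smul_apply, smul_eq_mul, mul_pow]
    rw [← mul_sum, ← hmu_sq, ← mul_pow, inv_mul_cancel₀ hmu_ne, one_pow]
  have hpay1 : x1 ⬝ᵥ A *ᵥ y1 = lam / mu := by
    rw [hAy_eq, dotProduct_smul, hself, hx1unit, smul_eq_mul, mul_one]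
  have hpay2 : y1 ⬝ᵥ B *ᵥ x1 = mu := by
    rw [hBx_eq, dotProduct_smul, hself, hy1unit, smul_eq_mul, mul_one]
  refine ⟨fun j => ?_, hy1unit, fun x' _ hx' => ?_, fun y' _ hy' => ?_, hpay1, hpay2⟩
  · rw [hy1]
    exact mul_nonneg (inv_nonneg.2 hmu_nonneg) (hBx j)
  · rw [hpay1, hAy_eq, dotProduct_smul]
    exact mul_le_of_le_one_right (by positivity) (dotProduct_le_one_of_sum_sq_eq_one hx' hx1unit)
  · rw [hpay2, hBx_eq, dotProduct_smul]
    exact mul_le_of_le_one_right hmu_nonneg (dotProduct_le_one_of_sum_sq_eq_one hy' hy1unit)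
end

section
/- Let A and B be n×n real matrices with all entries strictly positive such that AB = BA. If x ∈ ℝⁿ is entrywise positive and is an eigenvector of A (i.e., Ax = λx for some real λ), then x is also an eigenvector of B: there exists μ > 0 with Bx = μx. -/
open Matrix

/-- A positive eigenvector of an entrywise positive matrix spans its eigenspace. -/
theorem exists_eq_smul_of_mulVec_eq_smul_of_pos {ι : Type*} [Fintype ι] [Nonempty ι]
    {A : Matrix ι ι ℝ} (hA : ∀ i j, 0 < A i j) {x y : ι → ℝ} (hxpos : ∀ i, 0 < x i) {r : ℝ}
    (hx : A.mulVec x = r • x) (hy : A.mulVec y = r • y) : ∃ c : ℝ, y = c • x := by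
  obtain ⟨i, hi⟩ := Finite.exists_max fun j => y j / x j
  set c := y i / x i with hc
  have hz : ∀ j, 0 ≤ (c • x - y) j := fun j => by
    have h := (div_le_iff₀ (hxpos j)).1 (hi j)
    simpa using h
  have hzi : (c • x - y) i = 0 := by
    simp [hc, div_mul_cancel₀ _ (hxpos i).ne']
  have hAz : A.mulVec (c • x - y) = r • (c • x - y) := by
    rw [mulVec_sub, mulVec_smul, hx, hy, smul_sub, smul_comm]
  have hsum : ∑ j, A i j * (c • x - y) j = 0 := by
    have h := congrFun hAz i
    rw [Pi.smul_apply, hzi, smul_zero] at h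
    exact h
  rw [Finset.sum_eq_zero_iff_of_nonneg fun j _ => mul_nonneg (hA i j).le (hz j)] at hsum
  refine ⟨c, (sub_eq_zero.1 (funext fun j => ?_)).symm⟩
  exact (mul_eq_zero.1 (hsum j (Finset.mem_univ j))).resolve_left (hA i j).ne'

/-- if `A, B` are entrywise positive square matrices with `AB = BA`,
then any entrywise positive eigenvector `x` of `A` is also an eigenvector of `B`,
with a positive eigenvalue. -/
theorem commuting_pos_matrices_shared_positive_eigenvector {n : ℕ}
    (A B : Matrix (Fin n) (Fin n) ℝ)
    (hA : ∀ i j, 0 < A i j) (hB : ∀ i j, 0 < B i j)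
    (hcomm : A * B = B * A)
    (x : Fin n → ℝ) (hxpos : ∀ i, 0 < x i)
    (lam : ℝ) (hx : A.mulVec x = lam • x) :
    ∃ mu : ℝ, 0 < mu ∧ B.mulVec x = mu • x := by
  rcases isEmpty_or_nonempty (Fin n) with _ | ⟨⟨i⟩⟩
  · exact ⟨1, one_pos, Subsingleton.elim _ _⟩
  have : Nonempty (Fin n) := ⟨i⟩
  have hy : A.mulVec (B.mulVec x) = lam • B.mulVec x := by
    rw [mulVec_mulVec, hcomm, ← mulVec_mulVec, hx, mulVec_smul]
  obtain ⟨mu, hmu⟩ := exists_eq_smul_of_mulVec_eq_smul_of_pos hA hxpos hx hy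
  refine ⟨mu, ?_, hmu⟩
  have hpos : 0 < B.mulVec x i :=
    Finset.sum_pos (fun j _ => mul_pos (hB i j) (hxpos j)) Finset.univ_nonempty
  rw [hmu] at hpos
  exact pos_of_mul_pos_left hpos (hxpos i).le
end

section
/- Let A (m×n) and B (n×m) be entrywise positive real matrices. Suppose x ∈ ℝ^m is entrywise positive with ‖x‖₂ = 1 and (AB)x = λx for some λ > 0, and y ∈ ℝⁿ is entrywise positive with ‖y‖₂ = 1 and (BA)y = λ'y for some λ' > 0. Then y = Bx/‖Bx‖₂ and x = Ay/‖Ay‖₂; that is, the two equilibrium profiles (x, Bx/‖Bx‖₂) and (Ay/‖Ay‖₂, y) coincide. -/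
open Matrix Finset

/-- Two entrywise positive vectors on a nonempty finite type: some positive multiple of the second
lies below the first and touches it. -/
theorem exists_pos_smul_le_touching {ι : Type*} [Finite ι] [Nonempty ι]
    {u v : ι → ℝ} (hu : ∀ i, 0 < u i) (hv : ∀ i, 0 < v i) :
    ∃ c : ℝ, 0 < c ∧ (∀ i, c * v i ≤ u i) ∧ ∃ i, u i = c * v i := by
  obtain ⟨k, hk⟩ := Finite.exists_min fun i => u i / v i
  exact ⟨u k / v k, div_pos (hu k) (hv k), fun i => (le_div_iff₀ (hv i)).1 (hk i), k,
    (div_mul_cancel₀ _ (hv k).ne').symm⟩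

theorem sum_mul_sub_smul_of_eigenvectors {ι : Type*} [Fintype ι]
    {M : Matrix ι ι ℝ} {u v : ι → ℝ} {a b : ℝ} (hMu : M *ᵥ u = a • u) (hMv : M *ᵥ v = b • v)
    (c : ℝ) (i : ι) : ∑ j, M i j * (u j - c * v j) = a * u i - b * (c * v i) := by
  have h1 : ∑ j, M i j * u j = a * u i := congrFun hMu i
  have h2 : ∑ j, M i j * v j = b * v i := congrFun hMv i
  calc ∑ j, M i j * (u j - c * v j) = ∑ j, M i j * u j - c * ∑ j, M i j * v j := by
        rw [mul_sum, ← sum_sub_distrib]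
        exact sum_congr rfl fun j _ => by ring
    _ = a * u i - b * (c * v i) := by rw [h1, h2]; ring

/-- An eigenvalue of an entrywise positive matrix with an entrywise positive eigenvector is at least
any other such eigenvalue. -/
theorem eigenvalue_le_of_pos_eigenvectors {ι : Type*} [Fintype ι] [Nonempty ι]
    {M : Matrix ι ι ℝ} (hM : ∀ i j, 0 < M i j) {u v : ι → ℝ}
    (hu : ∀ i, 0 < u i) (hv : ∀ i, 0 < v i) {a b : ℝ}
    (hMu : M *ᵥ u = a • u) (hMv : M *ᵥ v = b • v) : b ≤ a := by
  obtain ⟨c, -, hle, k, hk⟩ := exists_pos_smul_le_touching hu hv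
  have h := sum_mul_sub_smul_of_eigenvectors hMu hMv c k
  have h0 : 0 ≤ ∑ j, M k j * (u j - c * v j) :=
    sum_nonneg fun j _ => mul_nonneg (hM k j).le (sub_nonneg.2 (hle j))
  rw [h, ← hk, sub_nonneg] at h0
  exact le_of_mul_le_mul_right h0 (hu k)

/-- Positive eigenvectors of an entrywise positive matrix are unique up to positive scaling. -/
theorem exists_pos_smul_eq_of_pos_eigenvectors {ι : Type*} [Fintype ι] [Nonempty ι]
    {M : Matrix ι ι ℝ} (hM : ∀ i j, 0 < M i j) {u v : ι → ℝ}
    (hu : ∀ i, 0 < u i) (hv : ∀ i, 0 < v i) {a b : ℝ}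
    (hMu : M *ᵥ u = a • u) (hMv : M *ᵥ v = b • v) : ∃ c : ℝ, 0 < c ∧ u = c • v := by
  obtain rfl : a = b := le_antisymm (eigenvalue_le_of_pos_eigenvectors hM hv hu hMv hMu)
    (eigenvalue_le_of_pos_eigenvectors hM hu hv hMu hMv)
  obtain ⟨c, hc, hle, k, hk⟩ := exists_pos_smul_le_touching hu hv
  have h := sum_mul_sub_smul_of_eigenvectors hMu hMv c k
  rw [← hk, sub_self, sum_eq_zero_iff_of_nonneg
    fun j _ => mul_nonneg (hM k j).le (sub_nonneg.2 (hle j))] at h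
  refine ⟨c, hc, funext fun j => ?_⟩
  have hj := (mul_eq_zero.1 (h j (mem_univ j))).resolve_left (hM k j).ne'
  exact sub_eq_zero.1 hj

theorem eq_inv_sqrt_smul_of_sum_sq_eq_one {ι : Type*} [Fintype ι] {y z : ι → ℝ} {c : ℝ}
    (hc : 0 < c) (hyz : y = c • z) (hy : ∑ i, y i ^ 2 = 1) :
    y = (Real.sqrt (∑ i, z i ^ 2))⁻¹ • z := by
  have h : c ^ 2 * ∑ i, z i ^ 2 = 1 := by
    rw [mul_sum, ← hy, hyz]
    exact sum_congr rfl fun i _ => by simp [mul_pow]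
  have hz : ∑ i, z i ^ 2 = c⁻¹ ^ 2 := by
    rw [inv_pow]
    exact eq_inv_of_mul_eq_one_right h
  rw [hz, Real.sqrt_sq (inv_pos.2 hc).le, inv_inv, hyz]

/-- The normalized positive eigenvector of `B * A` is the normalized image under `B` of any
positive eigenvector of `A * B`. -/
theorem eq_normalized_mulVec_of_pos_eigenvectors {ι κ : Type*} [Fintype ι] [Fintype κ]
    [Nonempty ι] [Nonempty κ] {A : Matrix ι κ ℝ} {B : Matrix κ ι ℝ}
    (hA : ∀ i j, 0 < A i j) (hB : ∀ j i, 0 < B j i)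
    {x : ι → ℝ} (hxpos : ∀ i, 0 < x i) {a : ℝ} (hx : (A * B) *ᵥ x = a • x)
    {y : κ → ℝ} (hypos : ∀ j, 0 < y j) (hyunit : ∑ j, y j ^ 2 = 1)
    {b : ℝ} (hy : (B * A) *ᵥ y = b • y) :
    y = (Real.sqrt (∑ j, (B *ᵥ x) j ^ 2))⁻¹ • B *ᵥ x := by
  have hBA : ∀ j j', 0 < (B * A) j j' := fun j j' =>
    sum_pos (fun i _ => mul_pos (hB j i) (hA i j')) univ_nonempty
  have hz : ∀ j, 0 < (B *ᵥ x) j := fun j =>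
    sum_pos (fun i _ => mul_pos (hB j i) (hxpos i)) univ_nonempty
  have hBz : (B * A) *ᵥ (B *ᵥ x) = a • B *ᵥ x := by
    rw [← mulVec_mulVec, mulVec_mulVec x A B, hx, mulVec_smul]
  obtain ⟨c, hc, h⟩ := exists_pos_smul_eq_of_pos_eigenvectors hBA hypos hz hy hBz
  exact eq_inv_sqrt_smul_of_sum_sq_eq_one hc h hyunit

theorem nonempty_of_sum_eq_one {ι : Type*} [Fintype ι] {f : ι → ℝ} (h : ∑ i, f i = 1) :
    Nonempty ι := by
  by_contra hι
  rw [not_nonempty_iff] at hι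
  simp at h

/-- for entrywise positive `A` (m×n), `B` (n×m), if `x > 0` is a unit
eigenvector of `AB` (with eigenvalue `λ > 0`) and `y > 0` is a unit eigenvector of
`BA` (with eigenvalue `λ' > 0`), then `y = Bx/‖Bx‖₂` and `x = Ay/‖Ay‖₂`; that is,
the two equilibrium profiles `(x, Bx/‖Bx‖₂)` and `(Ay/‖Ay‖₂, y)` coincide. -/
theorem pusg_two_perron_ne_coincide {m n : ℕ}
    (A : Matrix (Fin m) (Fin n) ℝ) (B : Matrix (Fin n) (Fin m) ℝ)
    (hA : ∀ i j, 0 < A i j) (hB : ∀ j i, 0 < B j i)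
    (x : Fin m → ℝ) (hxpos : ∀ i, 0 < x i) (hxunit : ∑ i, x i ^ 2 = 1)
    (lam : ℝ) (hlam : 0 < lam) (hx : (A * B).mulVec x = lam • x)
    (y : Fin n → ℝ) (hypos : ∀ j, 0 < y j) (hyunit : ∑ j, y j ^ 2 = 1)
    (lam' : ℝ) (hlam' : 0 < lam') (hy : (B * A).mulVec y = lam' • y) :
    y = (Real.sqrt (∑ j, B.mulVec x j ^ 2))⁻¹ • B.mulVec x ∧
    x = (Real.sqrt (∑ i, A.mulVec y i ^ 2))⁻¹ • A.mulVec y := by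
  have := nonempty_of_sum_eq_one hxunit
  have := nonempty_of_sum_eq_one hyunit
  exact ⟨eq_normalized_mulVec_of_pos_eigenvectors hA hB hxpos hx hypos hyunit hy,
    eq_normalized_mulVec_of_pos_eigenvectors hB hA hypos hy hxpos hxunit hx⟩
end

section
/- For every n ≥ 1, the minimum of ‖x‖₂² / ‖x‖_∞ over all x ∈ ℝⁿ with ‖x‖₁ = 1 equals 2/(√n + 1). That is, every x ∈ ℝⁿ with ‖x‖₁ = 1 satisfies ‖x‖₂² ≥ (2/(√n + 1))·‖x‖_∞, and there exists such an x attaining equality. -/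
/-- The vector that minimises `‖x‖₂²/‖x‖_∞` on the `ℓ¹` unit sphere, with peak at `k`. -/
noncomputable def peakedMinimizer {n : ℕ} (k i : Fin n) : ℝ :=
  1 / (√n * (√n + 1)) + if i = k then 1 / (√n + 1) else 0

theorem sum_mul_peakedMinimizer {n : ℕ} (k : Fin n) (f : Fin n → ℝ) :
    ∑ i, f i * peakedMinimizer k i =
      (∑ i, f i) * (1 / (√n * (√n + 1))) + f k * (1 / (√n + 1)) := by
  simp [peakedMinimizer, mul_add, Finset.sum_add_distrib, Finset.sum_mul]

theorem peakedMinimizer_nonneg {n : ℕ} (k i : Fin n) : 0 ≤ peakedMinimizer k i := by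
  unfold peakedMinimizer
  split_ifs <;> positivity

theorem peakedMinimizer_self {n : ℕ} (k : Fin n) : peakedMinimizer k k = 1 / √n := by
  have hs : 0 < √(n : ℝ) := Real.sqrt_pos.2 (Nat.cast_pos.2 k.pos)
  simp only [peakedMinimizer, if_true]
  field_simp
  ring

theorem peakedMinimizer_le_self {n : ℕ} (k i : Fin n) :
    peakedMinimizer k i ≤ peakedMinimizer k k := by
  simp only [peakedMinimizer, if_true]
  gcongr
  split_ifs
  · exact le_rfl
  · positivity

theorem sum_peakedMinimizer {n : ℕ} (k : Fin n) : ∑ i, peakedMinimizer k i = 1 := by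
  have hs : 0 < √(n : ℝ) := Real.sqrt_pos.2 (Nat.cast_pos.2 k.pos)
  have hsq : √(n : ℝ) ^ 2 = n := Real.sq_sqrt n.cast_nonneg
  have h := sum_mul_peakedMinimizer k 1
  simp only [Pi.one_apply, one_mul, Finset.sum_const, Finset.card_univ, Fintype.card_fin,
    nsmul_eq_mul, mul_one] at h
  rw [h, ← hsq, Real.sqrt_sq hs.le]
  field_simp

theorem sum_peakedMinimizer_sq {n : ℕ} (k : Fin n) :
    ∑ i, peakedMinimizer k i ^ 2 = 2 / (√n * (√n + 1)) := by
  have hs : 0 < √(n : ℝ) := Real.sqrt_pos.2 (Nat.cast_pos.2 k.pos)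
  simp only [sq]
  rw [sum_mul_peakedMinimizer, sum_peakedMinimizer, peakedMinimizer_self]
  field_simp
  ring

/-- for `n ≥ 1`, the minimum of `‖x‖₂²/‖x‖_∞` over `x ∈ ℝⁿ` with
`‖x‖₁ = 1` equals `2/(√n + 1)`: every such `x` satisfies
`‖x‖₂² ≥ (2/(√n+1))·‖x‖_∞`, and some such `x` attains equality. -/
theorem min_l2sq_over_linf_on_l1_sphere (n : ℕ) (hn : 1 ≤ n) :
    (∀ x : Fin n → ℝ, ∑ i, |x i| = 1 →
      (2 / (Real.sqrt n + 1)) * (⨆ i, |x i|) ≤ ∑ i, x i ^ 2) ∧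
    (∃ x : Fin n → ℝ, (∑ i, |x i| = 1) ∧
      ∑ i, x i ^ 2 = (2 / (Real.sqrt n + 1)) * (⨆ i, |x i|)) := by
  have : Nonempty (Fin n) := ⟨⟨0, hn⟩⟩
  constructor
  · intro x hx
    obtain ⟨k, hk⟩ := exists_eq_ciSup_of_finite (f := fun i => |x i|)
    rw [← hk]
    have h : 0 ≤ ∑ i, (|x i| - peakedMinimizer k i) ^ 2 :=
      Finset.sum_nonneg fun i _ => sq_nonneg _
    simp only [sub_sq, sq_abs, mul_assoc, Finset.sum_add_distrib, Finset.sum_sub_distrib,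
      ← Finset.mul_sum] at h
    rw [sum_mul_peakedMinimizer, sum_peakedMinimizer_sq, hx] at h
    linear_combination h
  · obtain ⟨k⟩ := this
    refine ⟨peakedMinimizer k, ?_, ?_⟩
    · simp only [abs_of_nonneg (peakedMinimizer_nonneg k _), sum_peakedMinimizer]
    · have hsup : ⨆ i, |peakedMinimizer k i| = 1 / √n := by
        simp only [abs_of_nonneg (peakedMinimizer_nonneg k _)]
        rw [← peakedMinimizer_self k]
        exact le_antisymm (@ciSup_le _ _ _ ⟨k⟩ _ _ (peakedMinimizer_le_self k))
          (le_ciSup (Set.finite_range (peakedMinimizer k)).bddAbove k)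
      rw [hsup, sum_peakedMinimizer_sq, div_mul_div_comm, mul_one, mul_comm √(n : ℝ)]
end

section
/- Let A (m×n) and B (n×m) be entrywise positive real matrices, and let x ∈ ℝ^m, y ∈ ℝⁿ be entrywise nonnegative unit-ℓ2 vectors satisfying Ay = λx and Bx = μy for some λ, μ > 0 (i.e., (x,y) is the Nash equilibrium of the induced positive unit-sphere game). Set x' = x/‖x‖₁ and y' = y/‖y‖₁. Then for every entrywise nonnegative x₁ ∈ ℝ^m with ‖x₁‖₁ = 1, x₁ᵀAy' ≤ ((√m + 1)/2)·x'ᵀAy', and for every entrywise nonnegative y₁ ∈ ℝⁿ with ‖y₁‖₁ = 1, y₁ᵀBx' ≤ ((√n + 1)/2)·y'ᵀBx'. In particular (x', y') is a multiplicative O(√max(m,n))-approximate mixed Nash equilibrium of the standard two-player game with payoff matrices A and B. -/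
open Matrix Finset

theorem coord_mul_sum_le_of_sum_sq_eq_one {m : ℕ} (x : Fin m → ℝ)
    (hx : ∑ i, x i ^ 2 = 1) (i : Fin m) :
    x i * ∑ j, x j ≤ (Real.sqrt m + 1) / 2 := by
  have hm : (0 : ℝ) < m := by exact_mod_cast i.pos
  have hs : 0 < Real.sqrt m := Real.sqrt_pos.mpr hm
  have hss : Real.sqrt m ^ 2 = m := Real.sq_sqrt hm.le
  set s := Real.sqrt m
  have hcs := Finset.sum_mul_sq_le_sq_mul_sq Finset.univ
    (fun j => (if j = i then s else 0) + 1) x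
  have h1 : ∑ j, ((if j = i then s else 0) + 1) * x j = s * x i + ∑ j, x j := by
    simp [add_mul, Finset.sum_add_distrib]
  have h2 : ∑ j, ((if j = i then s else 0) + 1) ^ 2 = s ^ 2 + 2 * s + m := by
    simp [add_sq, Finset.sum_add_distrib]
  rw [h1, h2, hx, mul_one, ← hss] at hcs
  have h3 : s * (x i * ∑ j, x j) ≤ s * ((s + 1) / 2) := by
    nlinarith [sq_nonneg (s * x i - ∑ j, x j)]
  exact le_of_mul_le_mul_left h3 hs

theorem dotProduct_mulVec_le_of_mulVec_eq_smul {m n : ℕ}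
    (A : Matrix (Fin m) (Fin n) ℝ) (x : Fin m → ℝ) (y : Fin n → ℝ)
    (hxnn : ∀ i, 0 ≤ x i) (hxunit : ∑ i, x i ^ 2 = 1)
    {lam : ℝ} (hlam : 0 < lam) (hAy : A.mulVec y = lam • x)
    (w : Fin m → ℝ) (hw : ∀ i, 0 ≤ w i) (hw1 : ∑ i, |w i| = 1) :
    w ⬝ᵥ A.mulVec ((∑ j, |y j|)⁻¹ • y) ≤
      ((Real.sqrt m + 1) / 2) *
        (((∑ i, |x i|)⁻¹ • x) ⬝ᵥ A.mulVec ((∑ j, |y j|)⁻¹ • y)) := by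
  have hd : 0 ≤ (∑ j, |y j|)⁻¹ :=
    inv_nonneg.mpr (Finset.sum_nonneg fun j _ => abs_nonneg (y j))
  simp only [abs_of_nonneg (hxnn _)]
  simp only [abs_of_nonneg (hw _)] at hw1
  have hxx : x ⬝ᵥ x = 1 := by simpa [dotProduct, sq] using hxunit
  have hS : 0 < ∑ i, x i := by
    refine (Finset.sum_nonneg fun i _ => hxnn i).lt_of_ne fun h => ?_
    have h0 := (Finset.sum_eq_zero_iff_of_nonneg fun i _ => hxnn i).mp h.symm
    have hx0 : x = 0 := funext fun i => h0 i (Finset.mem_univ i)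
    simp [hx0] at hxunit
  have hwx : (w ⬝ᵥ x) * ∑ i, x i ≤ (Real.sqrt m + 1) / 2 := by
    calc (w ⬝ᵥ x) * ∑ i, x i = ∑ i, w i * (x i * ∑ j, x j) := by
          simp [dotProduct, Finset.sum_mul, mul_assoc]
      _ ≤ ∑ i, w i * ((Real.sqrt m + 1) / 2) := Finset.sum_le_sum fun i _ =>
          mul_le_mul_of_nonneg_left (coord_mul_sum_le_of_sum_sq_eq_one x hxunit i) (hw i)
      _ = (Real.sqrt m + 1) / 2 := by rw [← Finset.sum_mul, hw1, one_mul]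
  simp only [Matrix.mulVec_smul, hAy, dotProduct_smul, smul_dotProduct, smul_eq_mul, hxx, mul_one]
  have h := mul_le_mul_of_nonneg_left ((le_div_iff₀ hS).mpr hwx) (mul_nonneg hd hlam.le)
  calc _ = _ := (mul_assoc _ _ _).symm
    _ ≤ _ := h
    _ = _ := by ring

/-- let `(x, y)` be the Nash equilibrium of the positive unit-sphere
game induced by entrywise positive `A`, `B` (so `Ay = λx`, `Bx = μy` with
`λ, μ > 0`), and let `x' = x/‖x‖₁`, `y' = y/‖y‖₁` be the ℓ1-normalizations. Then
`(x', y')` is a multiplicative `(√m+1)/2`- resp. `(√n+1)/2`-approximate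
(i.e. `O(√max(m,n))`-approximate) mixed Nash equilibrium of the standard
two-player game with payoff matrices `A` and `B`. -/
theorem pusg_ne_is_approx_msne {m n : ℕ}
    (A : Matrix (Fin m) (Fin n) ℝ) (B : Matrix (Fin n) (Fin m) ℝ)
    (hA : ∀ i j, 0 < A i j) (hB : ∀ j i, 0 < B j i)
    (x : Fin m → ℝ) (y : Fin n → ℝ)
    (hxnn : ∀ i, 0 ≤ x i) (hynn : ∀ j, 0 ≤ y j)
    (hxunit : ∑ i, x i ^ 2 = 1) (hyunit : ∑ j, y j ^ 2 = 1)
    (lam mu : ℝ) (hlam : 0 < lam) (hmu : 0 < mu)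
    (hAy : A.mulVec y = lam • x) (hBx : B.mulVec x = mu • y)
    (x' : Fin m → ℝ) (hx' : x' = (∑ i, |x i|)⁻¹ • x)
    (y' : Fin n → ℝ) (hy' : y' = (∑ j, |y j|)⁻¹ • y) :
    (∀ x1 : Fin m → ℝ, (∀ i, 0 ≤ x1 i) → ∑ i, |x1 i| = 1 →
      x1 ⬝ᵥ A.mulVec y' ≤ ((Real.sqrt m + 1) / 2) * (x' ⬝ᵥ A.mulVec y')) ∧
    (∀ y1 : Fin n → ℝ, (∀ j, 0 ≤ y1 j) → ∑ j, |y1 j| = 1 →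
      y1 ⬝ᵥ B.mulVec x' ≤ ((Real.sqrt n + 1) / 2) * (y' ⬝ᵥ B.mulVec x')) := by
  subst hx' hy'
  exact ⟨dotProduct_mulVec_le_of_mulVec_eq_smul A x y hxnn hxunit hlam hAy,
    dotProduct_mulVec_le_of_mulVec_eq_smul B y x hynn hyunit hmu hBx⟩
end

section
/- Let m ≥ 2 and let (A¹, …, A^m) be an m-player positive unit-sphere game (each tensor A^k entrywise positive). Then the game has a Nash equilibrium: there exist entrywise nonnegative vectors x_k ∈ ℝ^{n_k} with ‖x_k‖₂ = 1 for each k, such that each x_k maximizes player k's payoff over all entrywise nonnegative unit-ℓ2 vectors, holding the other players' strategies fixed. -/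
open Finset

/-- Player's payoff in an `m`-player unit-sphere game: for a payoff tensor `T`
indexed by action profiles and a strategy profile `x`, the payoff is
`Σ_{i₁,…,i_m} T_{i₁,…,i_m} · x_{1,i₁} ⋯ x_{m,i_m}`. -/
def tensorPayoff {m : ℕ} {n : Fin m → ℕ} (T : (∀ j, Fin (n j)) → ℝ)
    (x : ∀ j, Fin (n j) → ℝ) : ℝ :=
  ∑ i : ∀ j, Fin (n j), T i * ∏ j, x j (i j)

/-- `t ↦ det (1 + t • M)` is a polynomial function of degree at most the dimension. -/
lemma exists_polynomial_eval_eq_det_one_add_smul {E : Type*} [NormedAddCommGroup E]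
    [NormedSpace ℝ E] [FiniteDimensional ℝ E] (M : E →L[ℝ] E) :
    ∃ p : Polynomial ℝ, p.natDegree ≤ Module.finrank ℝ E ∧
      ∀ t : ℝ, p.eval t = (1 + t • M).det := by
  classical
  let b := Module.finBasis ℝ E
  let N := LinearMap.toMatrix b b (M : E →ₗ[ℝ] E)
  refine ⟨((Polynomial.X : Polynomial ℝ) • N.map Polynomial.C
    + (1 : Matrix _ _ ℝ).map Polynomial.C).det, ?_, fun t => ?_⟩
  · simpa using Polynomial.natDegree_det_X_add_C_le N 1
  · have h1 : (1 + t • M).det = (t • N + 1).det := by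
      rw [ContinuousLinearMap.det, ← LinearMap.det_toMatrix b]
      congr 1
      have : ((1 + t • M : E →L[ℝ] E) : E →ₗ[ℝ] E) = t • (M : E →ₗ[ℝ] E) + LinearMap.id := by
        ext x
        simp [add_comm]
      rw [this, map_add, map_smul, LinearMap.toMatrix_id]
    rw [h1, ← Polynomial.coe_evalRingHom, RingHom.map_det]
    congr 1
    ext i j
    simp [Matrix.one_apply]
    split_ifs <;> simp [mul_comm]

/-- Extrapolation from nodes in `[0, ε)` to `1`, uniformly over polynomials of bounded degree. -/
lemma exists_extrapolation_weights (d : ℕ) {ε : ℝ} (hε : 0 < ε) :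
    ∃ v w : ℕ → ℝ, (∀ j ∈ range (d + 1), 0 ≤ v j ∧ v j < ε) ∧ ∑ j ∈ range (d + 1), w j = 1 ∧
      ∀ p : Polynomial ℝ, p.natDegree ≤ d → p.eval 1 = ∑ j ∈ range (d + 1), w j * p.eval (v j) := by
  set v : ℕ → ℝ := fun j => ε * (j / (d + 1)) with hv
  have hd : (0 : ℝ) < d + 1 := by positivity
  have hinj : Set.InjOn v (range (d + 1) : Finset ℕ) := by
    intro i _ j _ hij
    simpa [hv, hε.ne', hd.ne', div_left_inj'] using hij
  refine ⟨v, fun j => (Lagrange.basis (range (d + 1)) v j).eval 1, fun j hj => ?_, ?_, ?_⟩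
  · refine ⟨by positivity, ?_⟩
    have : (j : ℝ) / (d + 1) < 1 := by
      rw [div_lt_one hd]
      exact_mod_cast mem_range.1 hj
    simpa using mul_lt_mul_of_pos_left this hε
  · rw [← Polynomial.eval_finsetSum, Lagrange.sum_basis hinj (by simp), Polynomial.eval_one]
  · intro p hp
    have hdeg : p.degree < ((range (d + 1)).card : ℕ) := by
      rw [card_range]
      exact (Polynomial.degree_le_of_natDegree_le hp).trans_lt (by exact_mod_cast Nat.lt_succ_self d)
    conv_lhs => rw [Lagrange.eq_interpolate hinj hdeg]
    simp [Lagrange.interpolate_apply, Polynomial.eval_finsetSum, mul_comm]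

section Brouwer

open Metric MeasureTheory

variable {E : Type*} [NormedAddCommGroup E] [InnerProductSpace ℝ E] [FiniteDimensional ℝ E]

/-- For small `t`, the map `x ↦ x + t • g x` is a bijection of the unit ball onto itself. -/
lemma image_ball_add_smul {g : E → E} (hg : ∀ x ∈ closedBall (0 : E) 1, ContDiffAt ℝ 1 g x)
    (hg1 : ∀ x ∈ closedBall (0 : E) 1, ‖x + g x‖ ≤ 1) (hg0 : ∀ x ∈ sphere (0 : E) 1, g x = 0)
    {t : ℝ} (ht0 : 0 ≤ t) (ht1 : t < 1)
    (hdet : ∀ x ∈ ball (0 : E) 1, (1 + t • fderiv ℝ g x).det ≠ 0) :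
    (fun x => x + t • g x) '' ball 0 1 = ball 0 1 := by
  set h : E → E := fun x => x + t • g x with hh
  have hmaps : ∀ x ∈ ball (0 : E) 1, h x ∈ ball (0 : E) 1 := by
    intro x hx
    have e : h x = (1 - t) • x + t • (x + g x) := by simp only [hh]; module
    have h2 := hg1 x (ball_subset_closedBall hx)
    rw [mem_ball_zero_iff] at hx ⊢
    rw [e]
    calc ‖(1 - t) • x + t • (x + g x)‖ ≤ ‖(1 - t) • x‖ + ‖t • (x + g x)‖ := norm_add_le _ _
      _ = (1 - t) * ‖x‖ + t * ‖x + g x‖ := by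
        rw [norm_smul, norm_smul, Real.norm_of_nonneg ht0, Real.norm_of_nonneg (by linarith)]
      _ < 1 := by nlinarith
  have hcont : ContinuousOn h (closedBall 0 1) := fun x hx =>
    (continuousAt_id.add ((hg x hx).continuousAt.const_smul t)).continuousWithinAt
  have hopen : IsOpen (h '' ball 0 1) := by
    rw [isOpen_iff_mem_nhds]
    rintro _ ⟨x, hx, rfl⟩
    have h1 : HasStrictFDerivAt h (1 + t • fderiv ℝ g x) x :=
      (hasStrictFDerivAt_id x).add
        (((hg x (ball_subset_closedBall hx)).hasStrictFDerivAt one_ne_zero).const_smul t)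
    rw [← ContinuousLinearMap.coe_toContinuousLinearEquivOfDetNeZero _ (hdet x hx)] at h1
    rw [← h1.map_nhds_eq_of_equiv]
    exact Filter.image_mem_map (isOpen_ball.mem_nhds hx)
  refine Set.Subset.antisymm (Set.image_subset_iff.2 hmaps) ?_
  refine (convex_ball (0 : E) 1).isPreconnected.subset_of_closure_inter_subset hopen
    ⟨h 0, hmaps 0 (by simp), 0, by simp, rfl⟩ ?_
  rintro y ⟨hy, hyb⟩
  have hclosed : IsClosed (h '' closedBall 0 1) :=
    ((isCompact_closedBall (0 : E) 1).image_of_continuousOn hcont).isClosed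
  obtain ⟨x, hx, rfl⟩ := closure_minimal (Set.image_mono ball_subset_closedBall) hclosed hy
  rcases (mem_closedBall_zero_iff.1 hx).lt_or_eq with hlt | heq
  · exact ⟨x, mem_ball_zero_iff.2 hlt, rfl⟩
  · have : h x = x := by simp [hh, hg0 x (mem_sphere_zero_iff_norm.2 heq)]
    rw [this, mem_ball_zero_iff] at hyb
    exact absurd heq hyb.ne

/-- There is no `C¹` retraction of the closed unit ball onto the unit sphere. -/
theorem no_contDiff_retraction {r : E → E}
    (hr : ∀ x ∈ closedBall (0 : E) 1, ContDiffAt ℝ 1 r x)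
    (hr1 : ∀ x ∈ closedBall (0 : E) 1, ‖r x‖ = 1) (hr0 : ∀ x ∈ sphere (0 : E) 1, r x = x) :
    False := by
  borelize E
  let μ : Measure E := Measure.addHaar
  set g : E → E := fun x => r x - x with hgdef
  have hg : ∀ x ∈ closedBall (0 : E) 1, ContDiffAt ℝ 1 g x := fun x hx =>
    (hr x hx).sub contDiffAt_id
  set D : E → E →L[ℝ] E := fderiv ℝ g with hD
  have hDcont : ContinuousOn D (closedBall 0 1) := fun x hx =>
    ((hg x hx).fderiv_right (m := 0) (by simp)).continuousAt.continuousWithinAt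
  have hgd : ∀ x ∈ closedBall (0 : E) 1, HasFDerivAt g (D x) x := fun x hx =>
    ((hg x hx).differentiableAt one_ne_zero).hasFDerivAt
  obtain ⟨C, hC⟩ := (isCompact_closedBall (0 : E) 1).exists_bound_of_continuousOn hDcont
  have hC0 : 0 ≤ C := (norm_nonneg _).trans (hC 0 (by simp))
  have hLip : ∀ x ∈ closedBall (0 : E) 1, ∀ y ∈ closedBall (0 : E) 1,
      ‖g y - g x‖ ≤ C * ‖y - x‖ := fun x hx y hy =>
    (convex_closedBall (0 : E) 1).norm_image_sub_le_of_norm_fderiv_le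
      (fun z hz => (hgd z hz).differentiableAt) hC hx hy
  have hdetcont : Continuous fun M : E →L[ℝ] E => M.det := ContinuousLinearMap.continuous_det
  obtain ⟨δ, hδ, hdet⟩ : ∃ δ > 0, ∀ M : E →L[ℝ] E, ‖M‖ < δ → 0 < (1 + M).det := by
    have hc : Continuous fun M : E →L[ℝ] E => (1 + M).det :=
      hdetcont.comp (continuous_const.add continuous_id)
    have h1 : 0 < (1 + (0 : E →L[ℝ] E)).det := by
      simp [ContinuousLinearMap.det]
    obtain ⟨δ, hδ, h⟩ := Metric.mem_nhds_iff.1 (hc.continuousAt.eventually_const_lt h1)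
    exact ⟨δ, hδ, fun M hM => h (mem_ball_zero_iff.2 hM)⟩
  set ε : ℝ := min 1 δ / (C + 1) with hεdef
  have hε : 0 < ε := by positivity
  have hεC : ε * (C + 1) = min 1 δ := by rw [hεdef]; field_simp
  obtain ⟨v, w, hv, hw, hvw⟩ := exists_extrapolation_weights (Module.finrank ℝ E) hε
  have hDint : ∀ t : ℝ, IntegrableOn (fun x => (1 + t • D x).det) (ball 0 1) μ := fun t =>
    ((hdetcont.comp_continuousOn (continuousOn_const.add (hDcont.const_smul t))).integrableOn_compact
      (isCompact_closedBall (0 : E) 1)).mono_set ball_subset_closedBall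
  have hsmall : ∀ t : ℝ, 0 ≤ t → t < ε →
      ∫ x in ball 0 1, (1 + t • D x).det ∂μ = μ.real (ball 0 1) := by
    intro t ht0 htε
    have htC : t * (C + 1) < min 1 δ := by
      rw [← hεC]; exact mul_lt_mul_of_pos_right htε (by positivity)
    have hpos : ∀ x ∈ ball (0 : E) 1, 0 < (1 + t • D x).det := by
      intro x hx
      apply hdet
      rw [norm_smul, Real.norm_of_nonneg ht0]
      have := hC x (ball_subset_closedBall hx)
      have := htC.trans_le (min_le_right _ _)
      nlinarith
    have hlt1 := htC.trans_le (min_le_left _ _)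
    have himg := image_ball_add_smul (g := g) hg
      (fun x hx => by simp [hgdef, hr1 x hx]) (fun x hx => by simp [hgdef, hr0 x hx])
      ht0 (by nlinarith) (fun x hx => (hpos x hx).ne')
    have hinj : Set.InjOn (fun x => x + t • g x) (ball 0 1) := by
      intro x hx y hy hxy
      have h1 := hLip x (ball_subset_closedBall hx) y (ball_subset_closedBall hy)
      have h2 : y - x = -(t • (g y - g x)) := by
        have : x + t • g x = y + t • g y := hxy
        rw [smul_sub, neg_sub, sub_eq_sub_iff_add_eq_add, ← this, add_comm]
      have h3 : ‖y - x‖ = t * ‖g y - g x‖ := by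
        conv_lhs => rw [h2]
        rw [norm_neg, norm_smul, Real.norm_of_nonneg ht0]
      have h4 : ‖y - x‖ = 0 := by
        by_contra hne
        have : 0 < ‖y - x‖ := lt_of_le_of_ne (norm_nonneg _) (Ne.symm hne)
        nlinarith [mul_le_mul_of_nonneg_left h1 ht0]
      exact (sub_eq_zero.1 (norm_eq_zero.1 h4)).symm
    have key := integral_image_eq_integral_abs_det_fderiv_smul μ
      (measurableSet_ball (x := (0 : E)) (ε := 1))
      (f := fun x => x + t • g x) (f' := fun x => 1 + t • D x)
      (fun x hx => ((hasFDerivAt_id x).add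
        ((hgd x (ball_subset_closedBall hx)).const_smul t)).hasFDerivWithinAt) hinj
      (fun _ => (1 : ℝ))
    rw [himg] at key
    simp only [smul_eq_mul, mul_one, integral_const, measureReal_restrict_apply_univ] at key
    rw [key]
    exact setIntegral_congr_fun measurableSet_ball fun x hx => (abs_of_pos (hpos x hx)).symm
  have hone : ∫ x in ball 0 1, (1 + (1 : ℝ) • D x).det ∂μ = μ.real (ball 0 1) := by
    calc ∫ x in ball 0 1, (1 + (1 : ℝ) • D x).det ∂μ
        = ∫ x in ball 0 1, ∑ j ∈ range (Module.finrank ℝ E + 1),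
            w j * (1 + v j • D x).det ∂μ := by
          congr 1
          ext x
          obtain ⟨p, hp, hpe⟩ := exists_polynomial_eval_eq_det_one_add_smul (D x)
          simp only [← hpe]
          exact hvw p hp
      _ = ∑ j ∈ range (Module.finrank ℝ E + 1), w j * μ.real (ball 0 1) := by
          rw [integral_finsetSum _ fun j _ => (hDint (v j)).const_mul (w j)]
          refine sum_congr rfl fun j hj => ?_
          rw [integral_const_mul, hsmall _ (hv j hj).1 (hv j hj).2]
      _ = μ.real (ball 0 1) := by rw [← sum_mul, hw, one_mul]
  have hzero : ∀ x ∈ ball (0 : E) 1, (1 + (1 : ℝ) • D x).det = 0 := by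
    intro x hx
    have hxc := ball_subset_closedBall hx
    have hrd : HasFDerivAt r (1 + (1 : ℝ) • D x) x := by
      have : HasFDerivAt (id + g) (1 + D x) x := (hasFDerivAt_id x).add (hgd x hxc)
      rw [one_smul]
      convert this using 1
      ext y
      simp [hgdef]
    by_contra hne
    set L := ContinuousLinearMap.toContinuousLinearEquivOfDetNeZero _ hne
    have hconst : (fun y => inner ℝ (r y) (r y)) =ᶠ[nhds x] fun _ => (1 : ℝ) := by
      filter_upwards [isOpen_ball.mem_nhds hx] with y hy
      rw [real_inner_self_eq_norm_sq, hr1 y (ball_subset_closedBall hy), one_pow]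
    have hd0 := (hrd.inner ℝ hrd).unique ((hasFDerivAt_const (1 : ℝ) x).congr_of_eventuallyEq hconst)
    have hv0 := congrArg (fun M => M (L.symm (r x))) hd0
    have hL : (1 + (1 : ℝ) • D x) (L.symm (r x)) = r x := by
      have := L.apply_symm_apply (r x)
      rwa [← ContinuousLinearEquiv.coe_coe,
        ContinuousLinearMap.coe_toContinuousLinearEquivOfDetNeZero] at this
    simp only [ContinuousLinearMap.comp_apply, ContinuousLinearMap.prod_apply, hL,
      fderivInnerCLM_apply, real_inner_self_eq_norm_sq, hr1 x hxc] at hv0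
    norm_num at hv0
  rw [setIntegral_congr_fun measurableSet_ball hzero] at hone
  have hpos : 0 < μ.real (ball (0 : E) 1) :=
    ENNReal.toReal_pos (measure_ball_pos μ 0 one_pos).ne' measure_ball_lt_top.ne
  simp at hone
  exact hpos.ne hone

/-- Brouwer's fixed point theorem for `C¹` self-maps of the closed unit ball. -/
theorem exists_fixedPoint_of_contDiff {f : E → E} (hf : ContDiff ℝ 1 f)
    (hmaps : ∀ x ∈ closedBall (0 : E) 1, ‖f x‖ ≤ 1) : ∃ x, f x = x := by
  by_contra! hne
  set u : E → E := fun x => x - f x with hu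
  set b : E → ℝ := fun x => inner ℝ x (u x) with hb
  set Δ : E → ℝ := fun x => b x ^ 2 + ‖u x‖ ^ 2 * (1 - ‖x‖ ^ 2) with hΔ
  set t : E → ℝ := fun x => (-b x + √(Δ x)) / ‖u x‖ ^ 2 with ht
  have hucd : ContDiff ℝ 1 u := contDiff_id.sub hf
  have hbcd : ContDiff ℝ 1 b := contDiff_id.inner ℝ hucd
  have hΔcd : ContDiff ℝ 1 Δ :=
    (hbcd.pow 2).add ((hucd.norm_sq ℝ).mul (contDiff_const.sub (contDiff_id.norm_sq ℝ)))
  have hupos : ∀ x, 0 < ‖u x‖ ^ 2 := fun x => by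
    have : 0 < ‖u x‖ := norm_pos_iff.2 (sub_ne_zero.2 (hne x).symm)
    positivity
  have hbpos : ∀ x ∈ sphere (0 : E) 1, 0 < b x := by
    intro x hx
    have h1 := hmaps x (sphere_subset_closedBall hx)
    rw [mem_sphere_zero_iff_norm] at hx
    have h2 := hupos x
    have h3 : b x = 1 - inner ℝ x (f x) := by
      simp [hb, hu, inner_sub_right, hx]
    simp only [hu] at h2
    rw [norm_sub_sq_real, hx] at h2
    nlinarith [norm_nonneg (f x)]
  have hΔpos : ∀ x ∈ closedBall (0 : E) 1, 0 < Δ x := by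
    intro x hx
    rcases (mem_closedBall_zero_iff.1 hx).lt_or_eq with hlt | heq
    · have h1 : 0 < 1 - ‖x‖ ^ 2 := by nlinarith [norm_nonneg x]
      have := mul_pos (hupos x) h1
      simp only [hΔ]
      positivity
    · have := hbpos x (mem_sphere_zero_iff_norm.2 heq)
      simp only [hΔ, heq]
      norm_num
      positivity
  refine no_contDiff_retraction (r := fun x => x + t x • u x) (fun x hx => ?_) (fun x hx => ?_)
    (fun x hx => ?_)
  · exact contDiffAt_id.add (ContDiffAt.smul
      ((hbcd.contDiffAt.neg.add (hΔcd.contDiffAt.sqrt (hΔpos x hx).ne')).div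
        (hucd.norm_sq ℝ).contDiffAt (hupos x).ne') hucd.contDiffAt)
  · have hs : √(Δ x) ^ 2 = b x ^ 2 + ‖u x‖ ^ 2 * (1 - ‖x‖ ^ 2) := Real.sq_sqrt (hΔpos x hx).le
    have htu : t x * ‖u x‖ ^ 2 = -b x + √(Δ x) := div_mul_cancel₀ _ (hupos x).ne'
    have hsq : ‖x + t x • u x‖ ^ 2 = 1 := by
      rw [norm_add_sq_real, inner_smul_right, norm_smul, mul_pow, Real.norm_eq_abs, sq_abs]
      change ‖x‖ ^ 2 + 2 * (t x * b x) + t x ^ 2 * ‖u x‖ ^ 2 = 1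
      refine mul_right_cancel₀ (hupos x).ne' ?_
      linear_combination (2 * b x + t x * ‖u x‖ ^ 2 - b x + √(Δ x)) * htu + hs
    exact (pow_eq_one_iff_of_nonneg (norm_nonneg _) two_ne_zero).1 hsq
  · have h1 : √(Δ x) = b x := by
      simp only [hΔ, mem_sphere_zero_iff_norm.1 hx]
      norm_num
      exact Real.sqrt_sq (hbpos x hx).le
    simp [ht, h1]

/-- A bounded `C¹` self-map of a finite-dimensional Euclidean space has a fixed point. -/
theorem exists_fixedPoint_of_contDiff_of_bounded {f : E → E} (hf : ContDiff ℝ 1 f) {R : ℝ}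
    (hR : ∀ x, ‖f x‖ ≤ R) : ∃ x, f x = x := by
  set Q : ℝ := max R 1
  have hQ : 0 < Q := lt_max_of_lt_right one_pos
  obtain ⟨x, hx⟩ := exists_fixedPoint_of_contDiff (f := fun x => Q⁻¹ • f (Q • x))
    ((hf.comp (contDiff_id.const_smul Q)).const_smul Q⁻¹) fun x _ => by
      rw [norm_smul, Real.norm_of_nonneg (by positivity), inv_mul_le_iff₀ hQ, mul_one]
      exact (hR _).trans (le_max_left _ _)
  exact ⟨Q • x, ((inv_smul_eq_iff₀ hQ.ne').1 hx)⟩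

end Brouwer

/-- Up to the factor `n k`, the payoff is the inner product of the strategy of player `k` with
the vector of weighted sums of the entries of `T`. -/
lemma card_mul_tensorPayoff_update {m : ℕ} {n : Fin m → ℕ} (T : (∀ j, Fin (n j)) → ℝ)
    (x : ∀ j, Fin (n j) → ℝ) (k : Fin m) (z : Fin (n k) → ℝ) :
    n k * tensorPayoff T (Function.update x k z) =
      ∑ i, z i * ∑ p : ∀ j, Fin (n j),
        T (Function.update p k i) * ∏ j ∈ univ.erase k, x j (p j) := by
  set w : (∀ j, Fin (n j)) → ℝ := fun p => ∏ j ∈ univ.erase k, x j (p j)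
  have hwu : ∀ p i, w (Function.update p k i) = w p := fun p i =>
    prod_congr rfl fun j hj => by rw [Function.update_of_ne (ne_of_mem_erase hj)]
  have hpay : tensorPayoff T (Function.update x k z) = ∑ p, T p * (z (p k) * w p) := by
    refine sum_congr rfl fun p _ => ?_
    rw [← mul_prod_erase univ _ (mem_univ k), Function.update_self]
    congr 2
    exact prod_congr rfl fun j hj => by rw [Function.update_of_ne (ne_of_mem_erase hj)]
  have hcard : n k * ∑ p, T p * (z (p k) * w p) =
      ∑ q : Fin (n k) × (∀ j, Fin (n j)), T q.2 * (z (q.2 k) * w q.2) := by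
    rw [Fintype.sum_prod_type]
    simp
  simp_rw [hpay, hcard, mul_sum]
  rw [← Fintype.sum_prod_type']
  have hinv : Function.Involutive fun q : Fin (n k) × (∀ j, Fin (n j)) =>
      (q.2 k, Function.update q.2 k q.1) := fun q => by simp
  rw [← Equiv.sum_comp hinv.toPerm]
  refine sum_congr rfl fun q _ => ?_
  simp only [Function.Involutive.coe_toPerm, Function.update_self, hwu]
  ring

/-- every `m`-player positive unit-sphere game (`m ≥ 2`, entrywise
positive payoff tensors) has a Nash equilibrium in entrywise nonnegative
unit-ℓ2 strategies. -/
theorem multiplayer_pusg_ne_exists {m : ℕ} (hm : 2 ≤ m) {n : Fin m → ℕ}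
    (hn : ∀ k, 0 < n k)
    (A : ∀ _ : Fin m, (∀ j, Fin (n j)) → ℝ)
    (hA : ∀ k i, 0 < A k i) :
    ∃ x : ∀ k, Fin (n k) → ℝ,
      (∀ k i, 0 ≤ x k i) ∧ (∀ k, ∑ i, x k i ^ 2 = 1) ∧
      (∀ k, ∀ z : Fin (n k) → ℝ, (∀ i, 0 ≤ z i) → ∑ i, z i ^ 2 = 1 →
        tensorPayoff (A k) (Function.update x k z) ≤ tensorPayoff (A k) x) := by
  classical
  have hne : ∀ k, Nonempty (Fin (n k)) := fun k => ⟨⟨0, hn k⟩⟩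
  obtain ⟨C, hC⟩ : ∃ C : ℝ, ∀ k p q, A k p ≤ C * A k q := by
    obtain ⟨C, hC⟩ := (Set.finite_range fun s : Fin m × (∀ j, Fin (n j)) × (∀ j, Fin (n j)) =>
      A s.1 s.2.1 / A s.1 s.2.2).bddAbove
    exact ⟨C, fun k p q => (div_le_iff₀ (hA k q)).1 (hC ⟨(k, p, q), rfl⟩)⟩
  let H : (k : Fin m) → Fin (n k) → EuclideanSpace ℝ (Σ k, Fin (n k)) → ℝ := fun k i y =>
    ∑ p : ∀ j, Fin (n j), A k (Function.update p k i) *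
      ∏ j ∈ univ.erase k, Real.exp (y ⟨j, p j⟩)
  let S : Fin m → EuclideanSpace ℝ (Σ k, Fin (n k)) → ℝ := fun k y => ∑ i, H k i y ^ 2
  have hHpos : ∀ k i y, 0 < H k i y := fun k i y =>
    sum_pos (fun p _ => mul_pos (hA _ _) (prod_pos fun j _ => Real.exp_pos _)) univ_nonempty
  have hSpos : ∀ k y, 0 < S k y := fun k y =>
    sum_pos (fun i _ => pow_pos (hHpos k i y) 2) univ_nonempty
  have hHle : ∀ k i i' y, H k i y ≤ C * H k i' y := fun k i i' y => by
    simp only [H, mul_sum, ← mul_assoc]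
    exact sum_le_sum fun p _ => mul_le_mul_of_nonneg_right (hC _ _ _)
      (prod_nonneg fun j _ => (Real.exp_pos _).le)
  have hcoord : ∀ s, ContDiff ℝ 1
      fun y : EuclideanSpace ℝ (Σ k, Fin (n k)) => y s := fun s => by fun_prop
  have hHcd : ∀ k i, ContDiff ℝ 1 (H k i) := fun k i =>
    ContDiff.sum fun p _ => contDiff_const.mul (contDiff_prod fun j _ => (hcoord _).exp)
  have hScd : ∀ k, ContDiff ℝ 1 (S k) := fun k => ContDiff.sum fun i _ => (hHcd k i).pow 2
  let f : EuclideanSpace ℝ (Σ k, Fin (n k)) → EuclideanSpace ℝ (Σ k, Fin (n k)) :=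
    fun y => WithLp.toLp 2 fun s =>
    Real.log (H s.1 s.2 y) - Real.log (S s.1 y) / 2
  have hf : ContDiff ℝ 1 f := by
    rw [contDiff_euclidean]
    exact fun s => ((hHcd s.1 s.2).log fun y => (hHpos _ _ y).ne').sub
      (((hScd s.1).log fun y => (hSpos _ y).ne').div_const 2)
  have hbound : ∀ y s, |f y s| ≤ Real.log (n s.1 * C ^ 2) / 2 := by
    rintro y ⟨k, i⟩
    have h1 : H k i y ^ 2 ≤ S k y :=
      single_le_sum (f := fun i => H k i y ^ 2) (fun i _ => sq_nonneg _) (mem_univ i)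
    have h2 : S k y ≤ n k * C ^ 2 * H k i y ^ 2 := by
      calc S k y ≤ ∑ _i' : Fin (n k), (C * H k i y) ^ 2 :=
            sum_le_sum fun i' _ => pow_le_pow_left₀ (hHpos k i' y).le (hHle k i' i y) 2
        _ = n k * C ^ 2 * H k i y ^ 2 := by simp; ring
    have hH2 : 0 < H k i y ^ 2 := pow_pos (hHpos k i y) 2
    have h3 : 0 < n k * C ^ 2 :=
      pos_of_mul_pos_left ((hSpos k y).trans_le h2) hH2.le
    have h4 := Real.log_le_log hH2 h1
    have h5 := Real.log_le_log (hSpos k y) h2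
    rw [Real.log_mul h3.ne' hH2.ne', Real.log_pow] at h5
    rw [Real.log_pow] at h4
    push_cast at h4 h5
    change |Real.log (H k i y) - Real.log (S k y) / 2| ≤ _
    rw [abs_le]
    constructor <;> dsimp only <;> linarith
  obtain ⟨y, hy⟩ := exists_fixedPoint_of_contDiff_of_bounded hf
    (R := √(∑ s : Σ k, Fin (n k), (Real.log (n s.1 * C ^ 2) / 2) ^ 2)) fun y => by
      rw [EuclideanSpace.norm_eq]
      exact Real.sqrt_le_sqrt (sum_le_sum fun s _ =>
        pow_le_pow_left₀ (norm_nonneg _) (hbound y s) 2)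
  have hx : ∀ k i, Real.exp (y ⟨k, i⟩) = H k i y / √(S k y) := by
    intro k i
    have h : y ⟨k, i⟩ = Real.log (H k i y) - Real.log (S k y) / 2 := by
      conv_lhs => rw [← hy]
    rw [h, Real.exp_sub, Real.exp_log (hHpos k i y), ← Real.log_sqrt (hSpos k y).le,
      Real.exp_log (Real.sqrt_pos.2 (hSpos k y))]
  have hpay : ∀ k (z : Fin (n k) → ℝ), n k * tensorPayoff (A k)
      (Function.update (fun k i => Real.exp (y ⟨k, i⟩)) k z) = ∑ i, z i * H k i y := fun k z =>
    card_mul_tensorPayoff_update (A k) _ k z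
  refine ⟨fun k i => Real.exp (y ⟨k, i⟩), fun k i => (Real.exp_pos _).le, fun k => ?_,
    fun k z _ hz => ?_⟩
  · simp_rw [hx, div_pow, ← sum_div, Real.sq_sqrt (hSpos k y).le]
    exact div_self (hSpos k y).ne'
  · refine le_of_mul_le_mul_left ?_ (Nat.cast_pos (α := ℝ).2 (hn k))
    have hself := hpay k fun i => Real.exp (y ⟨k, i⟩)
    rw [Function.update_eq_self k (fun k i => Real.exp (y ⟨k, i⟩))] at hself
    rw [hpay, hself]
    have hopt : ∑ i, Real.exp (y ⟨k, i⟩) * H k i y = √(S k y) := by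
      simp_rw [hx, div_mul_eq_mul_div, ← sq, ← sum_div]
      exact Real.div_sqrt
    rw [hopt]
    refine Real.le_sqrt_of_sq_le ?_
    simpa [hz] using sum_mul_sq_le_sq_mul_sq univ z fun i => H k i y
end

section
/- Let (A¹, …, A^m) be a Markov m-player positive unit-sphere game (normalized so that each fiber sum equals 1). For x = (x₁,…,x_m) and y = (y₁,…,y_m), each a tuple of entrywise nonnegative vectors with ‖x_k‖₁ = ‖y_k‖₁ = 1, and for every k, the marginal map satisfies ‖f(x)_k − f(y)_k‖₁ ≤ (1 − δ_k) · Σ_{i≠k} ‖x_i − y_i‖₁, where δ_k = min over subsets V ⊆ [n_k] of [ min_{(i_j)_{j≠k}} Σ_{i_k ∈ V} A^k_{i₁,…,i_m} + min_{(i_j)_{j≠k}} Σ_{i_k ∉ V} A^k_{i₁,…,i_m} ]. -/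
open Finset

/-- The marginal (expected-payoff) vector of player `k`. -/
def tensorMarginal {m : ℕ} {n : Fin m → ℕ} (T : (∀ j, Fin (n j)) → ℝ)
    (x : ∀ j, Fin (n j) → ℝ) (k : Fin m) (b : Fin (n k)) : ℝ :=
  ∑ i : ∀ j, Fin (n j),
    if i k = b then T i * ∏ j ∈ Finset.univ.erase k, x j (i j) else 0

/-- `δ_k` of a payoff tensor `T` of player `k`: the minimum over subsets
`V ⊆ [n_k]` of `min_{(i_j)_{j≠k}} Σ_{i_k ∈ V} T + min_{(i_j)_{j≠k}} Σ_{i_k ∉ V} T`. -/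
noncomputable def tensorDelta {m : ℕ} {n : Fin m → ℕ}
    (T : (∀ j, Fin (n j)) → ℝ) (k : Fin m) : ℝ :=
  sInf (Set.range fun V : Finset (Fin (n k)) =>
    sInf (Set.range fun i : ∀ j, Fin (n j) =>
      ∑ b ∈ V, T (Function.update i k b)) +
    sInf (Set.range fun i : ∀ j, Fin (n j) =>
      ∑ b ∈ Vᶜ, T (Function.update i k b)))

theorem sum_mul_le_half_oscillation {ι : Type*} [Fintype ι] (g w : ι → ℝ) (a M : ℝ)
    (ha : ∀ i, a ≤ g i) (hM : ∀ i, g i ≤ M) (hw : ∑ i, w i = 0) :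
    ∑ i, g i * w i ≤ (M - a) / 2 * ∑ i, |w i| := by
  have h : ∑ i, g i * w i = ∑ i, (g i - (M + a) / 2) * w i := by
    simp [sub_mul, Finset.sum_sub_distrib, ← Finset.mul_sum, hw]
  rw [h, Finset.mul_sum]
  refine Finset.sum_le_sum fun i _ => ?_
  calc (g i - (M + a) / 2) * w i ≤ |g i - (M + a) / 2| * |w i| := by
        rw [← abs_mul]; exact le_abs_self _
    _ ≤ (M - a) / 2 * |w i| := by
        refine mul_le_mul_of_nonneg_right ?_ (abs_nonneg _)
        rw [abs_le]
        constructor <;> linarith [ha i, hM i]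

theorem sum_abs_eq_two_mul_sum_nonneg {ι : Type*} [Fintype ι] (d : ι → ℝ)
    (hd : ∑ i, d i = 0) : ∑ i, |d i| = 2 * ∑ i with 0 ≤ d i, d i := by
  have h : ∀ i, |d i| = 2 * (if 0 ≤ d i then d i else 0) - d i := fun i => by
    split_ifs with h
    · rw [abs_of_nonneg h]; ring
    · rw [abs_of_neg (not_le.mp h)]; ring
  rw [Finset.sum_filter, Finset.mul_sum, Finset.sum_congr rfl fun i _ => h i,
    Finset.sum_sub_distrib, hd, sub_zero]

theorem prod_update_apply {ι : Type*} [Fintype ι] [DecidableEq ι] {κ : ι → Type*}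
    (h : ∀ j, κ j → ℝ) (a : ι) (u : κ a → ℝ) (i : ∀ j, κ j) :
    ∏ j, Function.update h a u j (i j) = u (i a) * ∏ j ∈ Finset.univ.erase a, h j (i j) := by
  rw [← Finset.mul_prod_erase _ _ (Finset.mem_univ a), Function.update_self]
  congr 1
  refine Finset.prod_congr rfl fun j hj => ?_
  rw [Function.update_of_ne (Finset.ne_of_mem_erase hj)]

/-- The ℓ1-distance of two product probability vectors is at most the sum of the ℓ1-distances
of the factors. -/
theorem sum_abs_prod_sub_prod_le {ι : Type*} [Fintype ι] [DecidableEq ι] {κ : ι → Type*}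
    [∀ j, Fintype (κ j)] (p q : ∀ j, κ j → ℝ)
    (hp : ∀ j b, 0 ≤ p j b) (hq : ∀ j b, 0 ≤ q j b)
    (hp1 : ∀ j, ∑ b, p j b = 1) (hq1 : ∀ j, ∑ b, q j b = 1) :
    ∑ i : ∀ j, κ j, |∏ j, p j (i j) - ∏ j, q j (i j)| ≤ ∑ j, ∑ b, |p j b - q j b| := by
  have key : ∀ s : Finset ι, ∑ i : ∀ j, κ j,
      |∏ j, s.piecewise p q j (i j) - ∏ j, q j (i j)| ≤ ∑ j ∈ s, ∑ b, |p j b - q j b| := by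
    intro s
    induction s using Finset.induction_on with
    | empty => simp
    | insert a s ha ih =>
      set h := s.piecewise p q with hh
      have hnn : ∀ j b, 0 ≤ h j b := fun j b => by
        by_cases hj : j ∈ s <;> simp [hh, hj, hp, hq]
      have h1 : ∀ j, ∑ b, h j b = 1 := fun j => by
        by_cases hj : j ∈ s <;> simp [hh, hj, hp1, hq1]
      have hha : h a = q a := by simp [hh, ha]
      have hstep : ∑ i : ∀ j, κ j, |∏ j, Function.update h a (p a) j (i j) - ∏ j, h j (i j)| =
          ∑ b, |p a b - q a b| := by
        have hpt : ∀ i : ∀ j, κ j,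
            |∏ j, Function.update h a (p a) j (i j) - ∏ j, h j (i j)| =
              ∏ j, Function.update h a (fun b => |p a b - q a b|) j (i j) := fun i => by
          rw [prod_update_apply, prod_update_apply,
            ← Finset.mul_prod_erase _ (fun j => h j (i j)) (Finset.mem_univ a), hha, ← sub_mul, abs_mul, abs_of_nonneg (Finset.prod_nonneg fun j _ => hnn j (i j))]
        rw [Finset.sum_congr rfl fun i _ => hpt i, ← Fintype.prod_sum,
          ← Finset.mul_prod_erase _ _ (Finset.mem_univ a), Function.update_self,
          Finset.prod_eq_one, mul_one]
        intro j hj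
        rw [Function.update_of_ne (Finset.ne_of_mem_erase hj), h1]
      rw [Finset.piecewise_insert, ← hh, Finset.sum_insert ha, ← hstep]
      refine le_trans ?_ (add_le_add_right ih _)
      rw [← Finset.sum_add_distrib]
      exact Finset.sum_le_sum fun i _ => abs_sub_le _ _ _
  simpa using key Finset.univ

/-- The mass that the marginal of player `k` gives to `V`, as an expectation over full strategy
profiles in which player `k` uses an arbitrary strategy `z`. -/
theorem sum_tensorMarginal_eq {m : ℕ} {n : Fin m → ℕ} (T : (∀ j, Fin (n j)) → ℝ)
    (x : ∀ j, Fin (n j) → ℝ) (k : Fin m) (z : Fin (n k) → ℝ) (hz : ∑ b, z b = 1)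
    (V : Finset (Fin (n k))) :
    ∑ b ∈ V, tensorMarginal T x k b =
      ∑ i : ∀ j, Fin (n j), (∑ b ∈ V, T (Function.update i k b)) *
        ∏ j, Function.update x k z j (i j) := by
  let swap : ((∀ j, Fin (n j)) × Fin (n k)) → ((∀ j, Fin (n j)) × Fin (n k)) :=
    fun q => (Function.update q.1 k q.2, q.1 k)
  have hswap : Function.Involutive swap := fun q => by simp [swap]
  let F : ((∀ j, Fin (n j)) × Fin (n k)) → ℝ := fun q =>
    if q.1 k ∈ V then T q.1 * (z q.2 * ∏ j ∈ Finset.univ.erase k, x j (q.1 j)) else 0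
  calc ∑ b ∈ V, tensorMarginal T x k b
      = ∑ i : ∀ j, Fin (n j), ∑ b, F (i, b) := by
        unfold tensorMarginal
        rw [Finset.sum_comm]
        refine Finset.sum_congr rfl fun i _ => ?_
        rw [Finset.sum_ite_eq]
        by_cases hi : i k ∈ V
        · simp only [F, hi, if_true]
          rw [← Finset.mul_sum, ← Finset.sum_mul, hz, one_mul]
        · simp [F, hi]
    _ = ∑ q, F (Function.Involutive.toPerm swap hswap q) := by
        rw [Equiv.sum_comp _ F, Fintype.sum_prod_type]
    _ = _ := by
        rw [Fintype.sum_prod_type]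
        refine Finset.sum_congr rfl fun i _ => ?_
        rw [prod_update_apply, Finset.sum_mul,
          ← Finset.sum_filter_add_sum_filter_not Finset.univ (· ∈ V),
          Finset.sum_eq_zero (s := Finset.univ.filter (· ∉ V)), add_zero,
          Finset.filter_mem_eq_inter, Finset.univ_inter]
        · refine Finset.sum_congr rfl fun b hb => ?_
          have he : ∏ j ∈ Finset.univ.erase k, x j (Function.update i k b j) =
              ∏ j ∈ Finset.univ.erase k, x j (i j) :=
            Finset.prod_congr rfl fun j hj => by
              rw [Function.update_of_ne (Finset.ne_of_mem_erase hj)]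
          simp [F, swap, hb, he]
        · intro b hb
          simp [F, swap, (Finset.mem_filter.mp hb).2]

theorem tensorDelta_le {m : ℕ} {n : Fin m → ℕ} (T : (∀ j, Fin (n j)) → ℝ) (k : Fin m)
    (V : Finset (Fin (n k))) :
    tensorDelta T k ≤
      sInf (Set.range fun i : ∀ j, Fin (n j) => ∑ b ∈ V, T (Function.update i k b)) +
      sInf (Set.range fun i : ∀ j, Fin (n j) => ∑ b ∈ Vᶜ, T (Function.update i k b)) :=
  csInf_le (Set.finite_range _).bddBelow ⟨V, rfl⟩

/-- in a normalized Markov `m`-player positive unit-sphere game, for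
tuples `x`, `y` of entrywise nonnegative ℓ1-unit vectors and every player `k`,
`‖f(x)_k − f(y)_k‖₁ ≤ (1 − δ_k) · Σ_{i≠k} ‖x_i − y_i‖₁`. -/
theorem markov_pusg_marginal_contraction {m : ℕ} {n : Fin m → ℕ}
    (A : ∀ _ : Fin m, (∀ j, Fin (n j)) → ℝ)
    (hA : ∀ k i, 0 < A k i)
    (hMarkov : ∀ (k : Fin m) (i : ∀ j, Fin (n j)),
      ∑ b : Fin (n k), A k (Function.update i k b) = 1)
    (x y : ∀ k, Fin (n k) → ℝ)
    (hxnn : ∀ k i, 0 ≤ x k i) (hynn : ∀ k i, 0 ≤ y k i)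
    (hxl1 : ∀ k, ∑ i, |x k i| = 1) (hyl1 : ∀ k, ∑ i, |y k i| = 1) :
    ∀ k, ∑ b, |tensorMarginal (A k) x k b - tensorMarginal (A k) y k b| ≤
      (1 - tensorDelta (A k) k) *
        ∑ j ∈ Finset.univ.erase k, ∑ i, |x j i - y j i| := by
  intro k
  have hx1 : ∀ j, ∑ b, x j b = 1 := fun j => by simpa [abs_of_nonneg (hxnn j _)] using hxl1 j
  have hy1 : ∀ j, ∑ b, y j b = 1 := fun j => by simpa [abs_of_nonneg (hynn j _)] using hyl1 j
  set p := Function.update x k (y k) with hp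
  have hpnn : ∀ j b, 0 ≤ p j b := fun j b => by
    rcases eq_or_ne j k with rfl | hj
    · simp [hp, hynn]
    · simp [hp, hj, hxnn]
  have hp1 : ∀ j, ∑ b, p j b = 1 := fun j => by
    rcases eq_or_ne j k with rfl | hj
    · simp [hp, hy1]
    · simp [hp, hj, hx1]
  have hw : ∑ i : ∀ j, Fin (n j), (∏ j, p j (i j) - ∏ j, y j (i j)) = 0 := by
    rw [Finset.sum_sub_distrib, ← Fintype.prod_sum, ← Fintype.prod_sum]
    simp [hp1, hy1]
  have hV : ∀ V : Finset (Fin (n k)),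
      ∑ b ∈ V, (tensorMarginal (A k) x k b - tensorMarginal (A k) y k b) =
        ∑ i : ∀ j, Fin (n j), (∑ b ∈ V, A k (Function.update i k b)) *
          (∏ j, p j (i j) - ∏ j, y j (i j)) := fun V => by
    rw [Finset.sum_sub_distrib, sum_tensorMarginal_eq _ x k (y k) (hy1 k),
      sum_tensorMarginal_eq _ y k (y k) (hy1 k), Function.update_eq_self,
      ← Finset.sum_sub_distrib]
    simp only [mul_sub, p]
  have hzero : ∑ b, (tensorMarginal (A k) x k b - tensorMarginal (A k) y k b) = 0 := by
    rw [hV]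
    simpa [hMarkov] using hw
  have hdist : ∑ i : ∀ j, Fin (n j), |∏ j, p j (i j) - ∏ j, y j (i j)| ≤
      ∑ j ∈ Finset.univ.erase k, ∑ b, |x j b - y j b| := by
    refine (sum_abs_prod_sub_prod_le p y hpnn hynn hp1 hy1).trans_eq ?_
    rw [← Finset.add_sum_erase _ _ (Finset.mem_univ k)]
    have hk : ∑ b, |p k b - y k b| = 0 := by simp [hp]
    rw [hk, zero_add]
    refine Finset.sum_congr rfl fun j hj => ?_
    rw [hp, Function.update_of_ne (Finset.ne_of_mem_erase hj)]
  rw [sum_abs_eq_two_mul_sum_nonneg _ hzero, hV]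
  set V : Finset (Fin (n k)) :=
    {b | 0 ≤ tensorMarginal (A k) x k b - tensorMarginal (A k) y k b}
  set a := sInf (Set.range fun i : ∀ j, Fin (n j) => ∑ b ∈ V, A k (Function.update i k b))
  set c := sInf (Set.range fun i : ∀ j, Fin (n j) => ∑ b ∈ Vᶜ, A k (Function.update i k b))
  have hal : ∀ i : ∀ j, Fin (n j), a ≤ ∑ b ∈ V, A k (Function.update i k b) := fun i =>
    csInf_le (Set.finite_range _).bddBelow ⟨i, rfl⟩
  have hcu : ∀ i : ∀ j, Fin (n j), ∑ b ∈ V, A k (Function.update i k b) ≤ 1 - c := fun i => by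
    have h1 : c ≤ ∑ b ∈ Vᶜ, A k (Function.update i k b) :=
      csInf_le (Set.finite_range _).bddBelow ⟨i, rfl⟩
    have h2 := Finset.sum_add_sum_compl V fun b => A k (Function.update i k b)
    rw [hMarkov] at h2
    linarith
  have hosc := sum_mul_le_half_oscillation _ _ a (1 - c) hal hcu hw
  have hdelta : tensorDelta (A k) k ≤ a + c := tensorDelta_le (A k) k V
  obtain ⟨i₀⟩ : Nonempty (∀ j, Fin (n j)) := by
    by_contra hne
    rw [not_nonempty_iff] at hne
    have h := Fintype.prod_sum y
    simp [hy1] at h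
  calc _ ≤ (1 - c - a) * ∑ i : ∀ j, Fin (n j), |∏ j, p j (i j) - ∏ j, y j (i j)| := by linarith
    _ ≤ (1 - c - a) * ∑ j ∈ Finset.univ.erase k, ∑ b, |x j b - y j b| :=
        mul_le_mul_of_nonneg_left hdist (by linarith [hal i₀, hcu i₀])
    _ ≤ _ := mul_le_mul_of_nonneg_right (by linarith)
        (Finset.sum_nonneg fun j _ => Finset.sum_nonneg fun b _ => abs_nonneg _)
end

section
/- Consider the 4-player unit-sphere game in which each player has 2 actions and the payoff tensors are A¹_{1112} = A¹_{2122} = A²_{1112} = A²_{1222} = A³_{1112} = A³_{2122} = A⁴_{1121} = A⁴_{2122} = 2 and all other entries are 0. Then for every pair (x₁, x₂) with x₁ ≥ 0, x₂ ≥ 0 and x₁² + x₂² = 1, the symmetric profile in which every player plays x = (x₁, x₂) is a Nash equilibrium, and each player's equilibrium payoff is 2x₁x₂; in particular this game has infinitely many Nash equilibria, realizing every equilibrium payoff in [0, 1]. -/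
open Finset

/-- Payoff of a player with tensor `T` in a 4-player 2-action unit-sphere game
under profile `s` (player `k` plays `s k`). -/
def payoff4 (T : Fin 2 → Fin 2 → Fin 2 → Fin 2 → ℝ) (s : Fin 4 → Fin 2 → ℝ) : ℝ :=
  ∑ i1, ∑ i2, ∑ i3, ∑ i4, T i1 i2 i3 i4 * s 0 i1 * s 1 i2 * s 2 i3 * s 3 i4

/-- The payoff tensors of the example: indices `1,2` of the paper correspond to
`0,1 : Fin 2`. `A¹_{1112} = A¹_{2122} = A²_{1112} = A²_{1222} = A³_{1112} =
A³_{2122} = A⁴_{1121} = A⁴_{2122} = 2`, all other entries `0`. -/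
def exTensor : Fin 4 → Fin 2 → Fin 2 → Fin 2 → Fin 2 → ℝ
  | 0 => fun i1 i2 i3 i4 =>
      if (i1, i2, i3, i4) = ((0 : Fin 2), (0 : Fin 2), (0 : Fin 2), (1 : Fin 2)) ∨
         (i1, i2, i3, i4) = ((1 : Fin 2), (0 : Fin 2), (1 : Fin 2), (1 : Fin 2)) then 2 else 0
  | 1 => fun i1 i2 i3 i4 =>
      if (i1, i2, i3, i4) = ((0 : Fin 2), (0 : Fin 2), (0 : Fin 2), (1 : Fin 2)) ∨
         (i1, i2, i3, i4) = ((0 : Fin 2), (1 : Fin 2), (1 : Fin 2), (1 : Fin 2)) then 2 else 0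
  | 2 => fun i1 i2 i3 i4 =>
      if (i1, i2, i3, i4) = ((0 : Fin 2), (0 : Fin 2), (0 : Fin 2), (1 : Fin 2)) ∨
         (i1, i2, i3, i4) = ((1 : Fin 2), (0 : Fin 2), (1 : Fin 2), (1 : Fin 2)) then 2 else 0
  | 3 => fun i1 i2 i3 i4 =>
      if (i1, i2, i3, i4) = ((0 : Fin 2), (0 : Fin 2), (1 : Fin 2), (0 : Fin 2)) ∨
         (i1, i2, i3, i4) = ((1 : Fin 2), (0 : Fin 2), (1 : Fin 2), (1 : Fin 2)) then 2 else 0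

/-- When all opponents play `(x₁, x₂)`, the payoff of a player who plays `z` is `2x₁x₂⟨z, x⟩`. -/
theorem payoff4_exTensor_update (x1 x2 : ℝ) (k : Fin 4) (z : Fin 2 → ℝ) :
    payoff4 (exTensor k) (Function.update (fun _ : Fin 4 => ![x1, x2]) k z) =
      2 * x1 * x2 * (z 0 * x1 + z 1 * x2) := by
  fin_cases k <;>
    simp [payoff4, exTensor, Function.update, Fin.sum_univ_two] <;> ring

theorem payoff4_exTensor_symmetric {x1 x2 : ℝ} (h : x1 ^ 2 + x2 ^ 2 = 1) (k : Fin 4) :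
    payoff4 (exTensor k) (fun _ : Fin 4 => ![x1, x2]) = 2 * x1 * x2 := by
  have hu := payoff4_exTensor_update x1 x2 k ![x1, x2]
  rw [Function.update_eq_self k (fun _ : Fin 4 => ![x1, x2])] at hu
  rw [hu, Matrix.cons_val_zero, Matrix.cons_val_one, Matrix.cons_val_zero]
  linear_combination 2 * x1 * x2 * h

theorem payoff4_exTensor_update_le {x1 x2 : ℝ} (h1 : 0 ≤ x1) (h2 : 0 ≤ x2)
    (h : x1 ^ 2 + x2 ^ 2 = 1) (k : Fin 4) (z : Fin 2 → ℝ) (hz : z 0 ^ 2 + z 1 ^ 2 = 1) :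
    payoff4 (exTensor k) (Function.update (fun _ : Fin 4 => ![x1, x2]) k z) ≤
      payoff4 (exTensor k) (fun _ : Fin 4 => ![x1, x2]) := by
  rw [payoff4_exTensor_update, payoff4_exTensor_symmetric h]
  refine mul_le_of_le_one_right (by positivity) ?_
  nlinarith [sq_nonneg (z 0 - x1), sq_nonneg (z 1 - x2)]

theorem exists_unit_two_mul_eq {p : ℝ} (hp : p ∈ Set.Icc (0 : ℝ) 1) :
    ∃ x1 x2 : ℝ, 0 ≤ x1 ∧ 0 ≤ x2 ∧ x1 ^ 2 + x2 ^ 2 = 1 ∧ 2 * x1 * x2 = p := by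
  obtain ⟨hp0, hp1⟩ := hp
  have hu : √(1 + p) ^ 2 = 1 + p := Real.sq_sqrt (by linarith)
  have hv : √(1 - p) ^ 2 = 1 - p := Real.sq_sqrt (by linarith)
  have hle : √(1 - p) ≤ √(1 + p) := Real.sqrt_le_sqrt (by linarith)
  refine ⟨(√(1 + p) + √(1 - p)) / 2, (√(1 + p) - √(1 - p)) / 2, by positivity,
    by linarith, ?_, ?_⟩
  · linear_combination (hu + hv) / 2
  · linear_combination (hu - hv) / 2

/-- in the 4-player unit-sphere game with tensors `exTensor`, every
symmetric profile where each player plays `(x₁, x₂)` with `x₁, x₂ ≥ 0` and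
`x₁² + x₂² = 1` is a Nash equilibrium with payoff `2x₁x₂` for every player; every
payoff in `[0,1]` is realized by some such equilibrium, and in particular the
game has infinitely many Nash equilibria. -/
theorem four_player_usg_continuum_of_ne :
    (∀ x1 x2 : ℝ, 0 ≤ x1 → 0 ≤ x2 → x1 ^ 2 + x2 ^ 2 = 1 →
      (∀ k : Fin 4, ∀ z : Fin 2 → ℝ, z 0 ^ 2 + z 1 ^ 2 = 1 →
        payoff4 (exTensor k) (Function.update (fun _ : Fin 4 => ![x1, x2]) k z) ≤
          payoff4 (exTensor k) (fun _ : Fin 4 => ![x1, x2])) ∧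
      (∀ k : Fin 4, payoff4 (exTensor k) (fun _ : Fin 4 => ![x1, x2]) = 2 * x1 * x2)) ∧
    (∀ p ∈ Set.Icc (0 : ℝ) 1, ∃ x1 x2 : ℝ, 0 ≤ x1 ∧ 0 ≤ x2 ∧
      x1 ^ 2 + x2 ^ 2 = 1 ∧ 2 * x1 * x2 = p) ∧
    {s : Fin 4 → Fin 2 → ℝ |
      (∀ k, s k 0 ^ 2 + s k 1 ^ 2 = 1) ∧
      (∀ k : Fin 4, ∀ z : Fin 2 → ℝ, z 0 ^ 2 + z 1 ^ 2 = 1 →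
        payoff4 (exTensor k) (Function.update s k z) ≤
          payoff4 (exTensor k) s)}.Infinite := by
  refine ⟨fun x1 x2 h1 h2 h => ⟨payoff4_exTensor_update_le h1 h2 h,
    payoff4_exTensor_symmetric h⟩, fun p hp => exists_unit_two_mul_eq hp, ?_⟩
  refine Set.Infinite.of_image (payoff4 (exTensor 0)) ?_
  refine (Set.Icc_infinite (zero_lt_one (α := ℝ))).mono fun p hp => ?_
  obtain ⟨x1, x2, h1, h2, h, rfl⟩ := exists_unit_two_mul_eq hp
  exact ⟨fun _ => ![x1, x2], ⟨fun _ => by simpa using h, payoff4_exTensor_update_le h1 h2 h⟩,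
    payoff4_exTensor_symmetric h 0⟩
end
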